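/- Let P be a homogeneous polynomial in two real variables of degree n ≥ 2 that is squarefree (has no multiple irreducible factors in ℝ[x,y]), and let f : ℝ × ℝ → ℝ be the function defined by evaluating P. Then the origin (0,0) is the only critical point of f: for every p ≠ (0,0), the Fréchet derivative D f(p) is nonzero. -/

import Mathlib

namespace MvPolynomial

theorem hasFDerivAt_eval_fin_two (Q : MvPolynomial (Fin 2) ℝ) (p : ℝ × ℝ) :
    HasFDerivAt (fun q : ℝ × ℝ => eval ![q.1, q.2] Q)
      (eval ![p.1, p.2] (pderiv 0 Q) • ContinuousLinearMap.fst ℝ ℝ ℝ +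
        eval ![p.1, p.2] (pderiv 1 Q) • ContinuousLinearMap.snd ℝ ℝ ℝ) p := by
  induction Q using MvPolynomial.induction_on with
  | C c => simpa using hasFDerivAt_const c p
  | add Q R hQ hR =>
    simp only [map_add]
    refine (hQ.add hR).congr_fderiv ?_
    ext <;> simp
  | mul_X Q i hQ =>
    simp only [map_mul, eval_X]
    fin_cases i
    · refine (hQ.mul (hasFDerivAt_fst (p := p))).congr_fderiv ?_
      ext <;> simp [pderiv_X, Derivation.leibniz]
    · refine (hQ.mul (hasFDerivAt_snd (p := p))).congr_fderiv ?_
      ext <;> simp [pderiv_X, Derivation.leibniz]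

theorem IsHomogeneous.aeval_mul_left {σ R A : Type*} [CommSemiring R] [CommSemiring A]
    [Algebra R A] {m : ℕ} {Q : MvPolynomial σ R} (hQ : Q.IsHomogeneous m) (c : A) (g : σ → A) :
    MvPolynomial.aeval (fun i => c * g i) Q = c ^ m * MvPolynomial.aeval g Q := by
  simp only [aeval_def, eval₂_eq, Finset.mul_sum]
  refine Finset.sum_congr rfl fun d hd => ?_
  have hdeg : ∑ i ∈ d.support, d i = m := by
    rw [← hQ (mem_support_iff.1 hd), Finsupp.weight_apply]
    simp [Finsupp.sum]
  rw [← hdeg, ← Finset.prod_pow_eq_pow_sum]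
  simp only [mul_pow, Finset.prod_mul_distrib]
  ring

/-- A binary form vanishing at a nonzero point is divisible by the linear form through it. -/
theorem IsHomogeneous.linear_dvd_of_eval_eq_zero {K : Type*} [Field K] {m : ℕ}
    {Q : MvPolynomial (Fin 2) K} (hQ : Q.IsHomogeneous m) {a b : K} (hab : a ≠ 0 ∨ b ≠ 0)
    (h0 : MvPolynomial.eval ![a, b] Q = 0) : C b * X 0 - C a * X 1 ∣ Q := by
  set L : MvPolynomial (Fin 2) K := C b * X 0 - C a * X 1 with hL
  let φ := Ideal.Quotient.mkₐ K (Ideal.span {L})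
  have key : ∀ (c : K) (M : MvPolynomial (Fin 2) K), c ≠ 0 →
      (∀ i, φ (M * C (![a, b] i)) = φ (C c * X i)) → L ∣ Q := by
    intro c M hc h
    have hscale : φ (C c ^ m * Q) = 0 := by
      have hleft := hQ.aeval_mul_left (φ (C c)) (fun i => φ (X i))
      have hright := hQ.aeval_mul_left (φ M) (fun i => φ (C (![a, b] i)))
      simp only [← map_mul, h] at hleft hright
      have hX : MvPolynomial.aeval (fun i => φ (X i)) Q = φ Q := by
        rw [← comp_aeval_apply, aeval_X_left_apply]
      have hC : MvPolynomial.aeval (fun i => φ (C (![a, b] i))) Q = 0 := by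
        have hcomp : (fun i => φ (C (![a, b] i))) =
            fun i => algebraMap K (MvPolynomial (Fin 2) K ⧸ Ideal.span {L}) (![a, b] i) :=
          _root_.funext fun i => φ.commutes _
        rw [hcomp]
        exact (aeval_algebraMap_apply _ _ Q).trans (by rw [aeval_eq_eval, h0, map_zero])
      rw [map_mul, map_pow, ← hX, ← hleft, hright, hC, mul_zero]
    have hdvd : L ∣ C c ^ m * Q := by
      rw [← Ideal.mem_span_singleton]
      exact Ideal.Quotient.eq_zero_iff_mem.1 hscale
    rw [← map_pow] at hdvd
    exact (((isUnit_iff_ne_zero.2 (pow_ne_zero m hc)).map C).dvd_mul_left).1 hdvd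
  have hφ : ∀ x y, L ∣ x - y → φ x = φ y := fun x y hxy =>
    Ideal.Quotient.eq.2 (Ideal.mem_span_singleton.2 hxy)
  rcases hab with ha | hb
  · refine key a (X 0) ha fun i => hφ _ _ ?_
    fin_cases i
    · simp [mul_comm]
    · exact ⟨1, by simp [hL, mul_comm]⟩
  · refine key b (X 1) hb fun i => hφ _ _ ?_
    fin_cases i
    · exact ⟨-1, by simp [hL, mul_comm]⟩
    · simp [mul_comm]

/-- A binary form whose partial derivatives vanish at a nonzero point is divisible by the square
of the linear form through it. -/
theorem IsHomogeneous.linear_mul_self_dvd_of_eval_pderiv_eq_zero {K : Type*} [Field K]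
    [CharZero K] {n : ℕ} (hn : n ≠ 0) {P : MvPolynomial (Fin 2) K} (hP : P.IsHomogeneous n)
    {a b : K} (hab : a ≠ 0 ∨ b ≠ 0)
    (h0 : ∀ i, MvPolynomial.eval ![a, b] (MvPolynomial.pderiv i P) = 0) :
    (C b * X 0 - C a * X 1) * (C b * X 0 - C a * X 1) ∣ P := by
  set L : MvPolynomial (Fin 2) K := C b * X 0 - C a * X 1 with hL
  have hd : ∀ i, L ∣ MvPolynomial.pderiv i P := fun i =>
    hP.pderiv.linear_dvd_of_eval_eq_zero hab (h0 i)
  have hLP : L ∣ P := by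
    have hnP : L ∣ C (n : K) * P := by
      rw [map_natCast, ← nsmul_eq_mul, ← hP.sum_X_mul_pderiv]
      exact Finset.dvd_sum fun i _ => (hd i).mul_left _
    exact (((isUnit_iff_ne_zero.2 (Nat.cast_ne_zero.2 hn)).map C).dvd_mul_left).1 hnP
  obtain ⟨Q, rfl⟩ := hLP
  refine mul_dvd_mul_left L ?_
  have hQ : ∀ i, L ∣ MvPolynomial.pderiv i L * Q := fun i => by
    have h := hd i
    rw [Derivation.leibniz, smul_eq_mul, smul_eq_mul, mul_comm Q] at h
    exact (dvd_add_right (dvd_mul_right _ _)).1 h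
  rcases hab with ha | hb
  · have h := hQ 1
    have hL1 : MvPolynomial.pderiv 1 L = C (-a) := by
      simp [hL, pderiv_X, Derivation.leibniz]
    rw [hL1] at h
    exact (((isUnit_iff_ne_zero.2 (neg_ne_zero.2 ha)).map C).dvd_mul_left).1 h
  · have h := hQ 0
    have hL0 : MvPolynomial.pderiv 0 L = C b := by
      simp [hL, pderiv_X, Derivation.leibniz]
    rw [hL0] at h
    exact (((isUnit_iff_ne_zero.2 hb).map C).dvd_mul_left).1 h

end MvPolynomial

/-- A squarefree homogeneous polynomial in two real variables of degree `n ≥ 2`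
has the origin as its only critical point. -/
theorem stmt_4 (n : ℕ) (hn : 2 ≤ n) (P : MvPolynomial (Fin 2) ℝ)
    (hhom : P.IsHomogeneous n) (hsq : Squarefree P)
    (f : ℝ × ℝ → ℝ) (hf : f = fun p : ℝ × ℝ => MvPolynomial.eval ![p.1, p.2] P) :
    ∀ p : ℝ × ℝ, p ≠ (0, 0) → fderiv ℝ f p ≠ 0 := by
  rintro ⟨a, b⟩ hp hcrit
  rw [hf, (MvPolynomial.hasFDerivAt_eval_fin_two P (a, b)).fderiv] at hcrit
  have hab : a ≠ 0 ∨ b ≠ 0 := by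
    by_contra! h
    exact hp (Prod.ext h.1 h.2)
  have h0 : ∀ i, MvPolynomial.eval ![a, b] (MvPolynomial.pderiv i P) = 0 := by
    intro i
    fin_cases i
    · simpa using DFunLike.congr_fun hcrit (1, 0)
    · simpa using DFunLike.congr_fun hcrit (0, 1)
  have hunit := hsq _ (hhom.linear_mul_self_dvd_of_eval_pderiv_eq_zero (by omega) hab h0)
  have heval := hunit.map (MvPolynomial.eval ![a, b])
  simp [mul_comm] at heval
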